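/- Let p be a prime and α₁,…,αₙ, β ≥ 1. Every function f : ℤ/p^{α₁}ℤ × ⋯ × ℤ/p^{αₙ}ℤ → ℤ/p^βℤ has finite functional degree, and FDEG(f) ≤ ∑_{j=1}^n p^{α_j} - n + (β-1)(p-1)p^{α_max - 1}, where α_max = max_j α_j. Moreover this bound is attained by some function. -/

import Mathlib

/-- The discrete difference operator: `(dOp g f) x = f (x + g) - f x`. -/
def dOp {A B : Type*} [AddCommGroup A] [AddCommGroup B] (g : A) (f : A → B) : A → B :=
  fun x => f (x + g) - f x

/-- Iterated partial difference operator `Δ₁^{d₁} ⋯ Δₙ^{dₙ}` w.r.t. elements `e i`. -/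
def iterD {n : ℕ} {A B : Type*} [AddCommGroup A] [AddCommGroup B]
    (e : Fin n → A) (d : Fin n → ℕ) (f : A → B) : A → B :=
  (List.finRange n).foldr (fun i g => (dOp (e i))^[d i] g) f

open fwdDiff in
theorem dOp_iter_sum {A B : Type*} [AddCommGroup A] [AddCommGroup B] (g : A) (f : A → B)
    (q : ℕ) (hq : 0 < q) (hg : q • g = 0) :
    (dOp g)^[q] f = - ∑ k ∈ Finset.range (q - 1), (q.choose (k+1)) • (dOp g)^[k+1] f := by
  have hd : (dOp g : (A → B) → A → B) = fwdDiff g := rfl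
  rw [hd]
  funext y
  have h := shift_eq_sum_fwdDiff_iter g f q y
  rw [hg, add_zero] at h
  obtain ⟨r, rfl⟩ : ∃ r, q = r + 1 := ⟨q - 1, by omega⟩
  rw [Finset.sum_range_succ, Finset.sum_range_succ'] at h
  simp only [Nat.choose_self, one_smul, Nat.choose_zero_right, Function.iterate_zero, id] at h
  simp only [Pi.neg_apply, Finset.sum_apply, Pi.smul_apply, Nat.add_sub_cancel]
  rw [eq_neg_iff_add_eq_zero]
  have : ∀ a b c : B, c = a + c + b → b + a = 0 := by
    intro a b c h
    have : a + c + b - c = 0 := by rw [← h]; simp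
    rw [← this]; abel
  exact this _ _ _ h

theorem dOp_comm {A B : Type*} [AddCommGroup A] [AddCommGroup B] (g h : A) :
    Function.Commute (dOp g : (A → B) → A → B) (dOp h) := by
  intro f
  funext x
  simp only [dOp]
  rw [add_right_comm x g h]
  abel

def foldD {n : ℕ} {A B : Type*} [AddCommGroup A] [AddCommGroup B]
    (e : Fin n → A) (l : List (Fin n)) (d : Fin n → ℕ) (f : A → B) : A → B :=
  l.foldr (fun i g => (dOp (e i))^[d i] g) f

section
variable {n : ℕ} {A B : Type*} [AddCommGroup A] [AddCommGroup B]

theorem foldD_cons (e : Fin n → A) (i : Fin n) (l : List (Fin n)) (d : Fin n → ℕ) (f : A → B) :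
    foldD e (i :: l) d f = (dOp (e i))^[d i] (foldD e l d f) := rfl

theorem foldD_congr (e : Fin n → A) (l : List (Fin n)) (d d' : Fin n → ℕ) (f : A → B)
    (h : ∀ i ∈ l, d i = d' i) : foldD e l d f = foldD e l d' f := by
  induction l with
  | nil => rfl
  | cons i t ih =>
    rw [foldD_cons, foldD_cons, h i (by simp), ih (fun k hk => h k (by simp [hk]))]

theorem foldD_comm (e : Fin n → A) (l : List (Fin n)) (d : Fin n → ℕ) (f : A → B) (g : A)
    (k : ℕ) : foldD e l d ((dOp g)^[k] f) = (dOp g)^[k] (foldD e l d f) := by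
  induction l with
  | nil => rfl
  | cons i t ih =>
    rw [foldD_cons, foldD_cons, ih]
    exact ((dOp_comm (e i) g).iterate_iterate _ _ _)

theorem foldD_single (e : Fin n → A) (l : List (Fin n)) (hl : l.Nodup) (d : Fin n → ℕ)
    (f : A → B) (j : Fin n) (hj : j ∈ l) (k : ℕ) :
    foldD e l (d + Pi.single j k) f = foldD e l d ((dOp (e j))^[k] f) := by
  induction l with
  | nil => simp at hj
  | cons i t ih =>
    rw [foldD_cons, foldD_cons]
    rw [List.nodup_cons] at hl
    by_cases hij : j = i
    · subst hij
      rw [foldD_comm, ← Function.iterate_add_apply]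
      rw [foldD_congr e t (d + (Pi.single j k : Fin n → ℕ)) d f]
      · simp
      · intro i hi
        have : i ≠ j := fun h => hl.1 (h ▸ hi)
        simp [this]
    · rw [ih hl.2 (by simpa [hij] using hj)]
      have : i ≠ j := fun h => hij h.symm
      simp [this]

def dHom (g : A) : (A → B) →+ (A → B) where
  toFun := dOp g
  map_zero' := by funext x; simp [dOp]
  map_add' := by intro f h; funext x; simp only [dOp, Pi.add_apply]; abel

theorem dOp_iter_hom (g : A) (k : ℕ) : ∃ φ : (A → B) →+ (A → B), ∀ f, φ f = (dOp g)^[k] f := by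
  induction k with
  | zero => exact ⟨AddMonoidHom.id _, fun f => rfl⟩
  | succ k ih =>
    obtain ⟨φ, h⟩ := ih
    exact ⟨φ.comp (dHom g), fun f => by
      rw [Function.iterate_succ_apply, ← h]; rfl⟩

theorem foldD_hom (e : Fin n → A) (l : List (Fin n)) (d : Fin n → ℕ) :
    ∃ φ : (A → B) →+ (A → B), ∀ f, φ f = foldD e l d f := by
  induction l with
  | nil => exact ⟨AddMonoidHom.id _, fun f => rfl⟩
  | cons i t ih =>
    obtain ⟨φ, h⟩ := ih
    obtain ⟨ψ, h'⟩ := dOp_iter_hom (B := B) (e i) (d i)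
    exact ⟨ψ.comp φ, fun f => by rw [foldD_cons, ← h, ← h']; rfl⟩

theorem iterD_single (e : Fin n → A) (d : Fin n → ℕ) (f : A → B) (j : Fin n) (k : ℕ) :
    iterD e (d + Pi.single j k) f = iterD e d ((dOp (e j))^[k] f) :=
  foldD_single e _ (List.nodup_finRange n) d f j (by simp) k

theorem iterD_reduce (e : Fin n → A) (d : Fin n → ℕ) (f : A → B) (j : Fin n)
    (q : ℕ) (hq : 0 < q) (hg : q • e j = 0) :
    iterD e (d + Pi.single j q) f =
      - ∑ k ∈ Finset.range (q - 1), (q.choose (k+1)) • iterD e (d + Pi.single j (k+1)) f := by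
  simp only [iterD_single]
  rw [dOp_iter_sum _ _ q hq hg]
  obtain ⟨φ, h⟩ := foldD_hom (B := B) e (List.finRange n) d
  have h' : ∀ f, iterD e d f = φ f := fun f => (h f).symm
  simp only [h', map_neg, map_sum, map_nsmul]

theorem pow_ineq (p v i : ℕ) (hp : 2 ≤ p) :
    p ^ (v + i + 1) ≤ (i + 1) * ((p - 1) * p ^ (v + i)) + p ^ v ∧
    (1 ≤ i → p ^ (v + i + 1) < (i + 1) * ((p - 1) * p ^ (v + i)) + p ^ v) := by
  obtain ⟨r, rfl⟩ : ∃ r, p = r + 1 := ⟨p - 1, by omega⟩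
  simp only [Nat.add_sub_cancel]
  induction i with
  | zero => constructor
            · simp [pow_succ]; nlinarith
            · simp
  | succ i ih =>
    have h1 := ih.1
    have h3 : 0 < (r+1)^(v+i) := by positivity
    have : (r+1)^(v+(i+1)+1) < (i+1+1) * (r * (r+1)^(v+(i+1))) + (r+1)^v := by
      have e1 : (r+1)^(v+(i+1)+1) = (r+1) * (r+1)^(v+i+1) := by ring
      have e2 : (r+1)^(v+(i+1)) = (r+1)^(v+i+1) := by ring
      have h2 : (r+1)^(v+i) < (r+1)^(v+i+1) := Nat.pow_lt_pow_right (by omega) (by omega)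
      have h4 : (i+1) * (r * (r+1)^(v+i)) < (i+1) * (r * (r+1)^(v+i+1)) := by
        apply Nat.mul_lt_mul_of_pos_left _ (by omega)
        apply Nat.mul_lt_mul_of_pos_left h2 (by omega)
      rw [e1, e2]
      nlinarith
    exact ⟨this.le, fun _ => this⟩

theorem choose_fact (p : ℕ) (hp : p.Prime) (a k : ℕ) (hk : 0 < k) (hk' : k < p ^ a) :
    ∃ i c, 1 ≤ i ∧ i ≤ a ∧ (p^a).choose k = p ^ i * c ∧ ¬ p ∣ c ∧
      p ^ a ≤ i * ((p - 1) * p ^ (a - 1)) + k ∧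
      (k ≠ p ^ (a - 1) → p ^ a < i * ((p - 1) * p ^ (a - 1)) + k) ∧
      (k = p ^ (a - 1) → i = 1) := by
  obtain ⟨v, w, hw, rfl⟩ := Nat.exists_eq_pow_mul_and_not_dvd hk.ne' p hp.ne_one
  have hw0 : 0 < w := Nat.pos_of_mul_pos_left hk
  have hpv : 0 < p ^ v := pow_pos hp.pos v
  have hva : v < a := by
    rw [← Nat.pow_lt_pow_iff_right hp.one_lt]
    nlinarith
  obtain ⟨i, rfl⟩ : ∃ i, a = v + i + 1 := ⟨a - v - 1, by omega⟩
  have hch : ((p^(v+i+1)).choose (p^v*w)) ≠ 0 := (Nat.choose_pos hk'.le).ne'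
  obtain ⟨s, c, hc, hsc⟩ := Nat.exists_eq_pow_mul_and_not_dvd hch p hp.ne_one
  have hm := hp.emultiplicity_choose_prime_pow_add_emultiplicity hk'.le hk.ne'
  have f1 : emultiplicity p ((p^(v+i+1)).choose (p^v*w)) = s := by
    rw [emultiplicity_eq_coe]
    refine ⟨⟨c, hsc⟩, ?_⟩
    rw [hsc, pow_succ, Nat.mul_dvd_mul_iff_left (pow_pos hp.pos s)]; exact hc
  have f2 : emultiplicity p (p^v*w) = v := by
    rw [emultiplicity_eq_coe]
    refine ⟨⟨w, rfl⟩, ?_⟩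
    rw [pow_succ, Nat.mul_dvd_mul_iff_left hpv]; exact hw
  rw [f1, f2] at hm
  have hs : s = i + 1 := by
    have : s + v = v + i + 1 := by exact_mod_cast hm
    omega
  subst hs
  have ineq := pow_ineq p v i hp.two_le
  have hvw : p ^ v ≤ p ^ v * w := by nlinarith
  simp only [Nat.add_sub_cancel]
  refine ⟨i+1, c, by omega, by omega, hsc, hc, by omega, ?_, ?_⟩
  · intro hne
    rcases Nat.eq_zero_or_pos i with rfl | hi
    · have : p ^ v < p ^ v * w := lt_of_le_of_ne hvw (fun h => hne (by simpa using h.symm))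
      omega
    · have := ineq.2 hi
      omega
  · intro h
    rw [pow_add] at h
    have : w = p ^ i := Nat.eq_of_mul_eq_mul_left hpv h
    rcases Nat.eq_zero_or_pos i with rfl | hi
    · rfl
    · exact absurd (this ▸ dvd_pow_self p hi.ne') hw

theorem upper (p : ℕ) (hp : p.Prime) (e : Fin n → A) (α : Fin n → ℕ) (a : ℕ)
    (ha : ∀ j, α j ≤ a) (he : ∀ j, p ^ α j • e j = 0) (β : ℕ) (hB : ∀ b : B, p ^ β • b = 0)
    (f : A → B) (s : ℕ) : ∀ (m : ℕ) (d : Fin n → ℕ), β ≤ m + s →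
      ∑ j, (p ^ α j - 1) + (β - 1) * ((p - 1) * p ^ (a - 1)) <
        ∑ j, d j + m * ((p - 1) * p ^ (a - 1)) →
      p ^ m • iterD e d f = 0 := by
  have hz : ∀ m, β ≤ m → ∀ g : A → B, p ^ m • g = 0 := by
    intro m hm g
    obtain ⟨r, rfl⟩ := Nat.exists_eq_add_of_le hm
    funext x
    rw [pow_add, mul_comm, mul_smul, Pi.smul_apply, Pi.smul_apply, hB]; simp
  induction s with
  | zero => intro m d h _; exact hz m h _
  | succ s ih =>
    intro m d h hd
    by_cases hm : β ≤ m
    · exact hz m hm _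
    obtain ⟨j, hj⟩ : ∃ j, p ^ α j ≤ d j := by
      by_contra! hcon
      have h1 : ∑ j, d j ≤ ∑ j, (p ^ α j - 1) :=
        Finset.sum_le_sum (fun j _ => by have := hcon j; omega)
      have h2 : m * ((p - 1) * p ^ (a - 1)) ≤ (β - 1) * ((p - 1) * p ^ (a - 1)) :=
        Nat.mul_le_mul_right _ (by omega)
      omega
    obtain ⟨d', rfl⟩ : ∃ d' : Fin n → ℕ, d = d' + Pi.single j (p ^ α j) := by
      refine ⟨d - Pi.single j (p ^ α j), ?_⟩
      funext i
      by_cases hi : i = j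
      · subst hi; simp; omega
      · simp [hi]
    rw [iterD_reduce e d' f j _ (pow_pos hp.pos _) (he j), smul_neg, neg_eq_zero,
      Finset.smul_sum]
    apply Finset.sum_eq_zero
    intro k hk
    rw [Finset.mem_range] at hk
    obtain ⟨i, c, hi, -, hc, -, hle, -, -⟩ := choose_fact p hp (α j) (k+1) (by omega) (by omega)
    have hmono : (p - 1) * p ^ (α j - 1) ≤ (p - 1) * p ^ (a - 1) :=
      Nat.mul_le_mul_left _ (Nat.pow_le_pow_right hp.pos (by have := ha j; omega))
    have hmono' := Nat.mul_le_mul_left i hmono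
    rw [hc, ← mul_smul, ← mul_assoc, ← pow_add, mul_comm, mul_smul, ih, smul_zero]
    · omega
    · simp only [Pi.add_apply, Finset.sum_add_distrib, Finset.sum_pi_single', Finset.mem_univ,
        if_true, Finset.sum_pi_single] at hd ⊢
      rw [add_mul]
      omega

theorem lower (p : ℕ) (hp : p.Prime) (e : Fin n → A) (α : Fin n → ℕ) (j : Fin n)
    (ha : ∀ i, α i ≤ α j) (hj : 1 ≤ α j) (he : ∀ j, p ^ α j • e j = 0) (β : ℕ)
    (hB : ∀ b : B, p ^ β • b = 0)
    (f : A → B) (t : ℕ) : ∀ m, m + t + 1 = β →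
      p ^ m • iterD e ((fun i => p ^ α i - 1) +
        Pi.single j (t * ((p - 1) * p ^ (α j - 1)))) f = 0 →
      p ^ (β - 1) • iterD e (fun i => p ^ α i - 1) f = 0 := by
  induction t with
  | zero =>
    intro m hm h
    obtain rfl : m = β - 1 := by omega
    simpa using h
  | succ t ih =>
    intro m hm h
    apply ih (m+1) (by omega)
    have hpe : p ^ α j = (p - 1) * p ^ (α j - 1) + p ^ (α j - 1) := by
      obtain ⟨r, hr⟩ : ∃ r, α j = r + 1 := ⟨α j - 1, by omega⟩
      obtain ⟨s, hs⟩ : ∃ s, p = s + 1 := ⟨p - 1, by have := hp.pos; omega⟩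
      rw [hr, hs]; simp only [Nat.add_sub_cancel]; ring
    have hpos : 0 < p ^ (α j - 1) := pow_pos hp.pos _
    have hWpos : 0 < (p - 1) * p ^ (α j - 1) :=
      Nat.mul_pos (by have := hp.two_le; omega) hpos
    set W := (p - 1) * p ^ (α j - 1) with hW
    set P := p ^ (α j - 1) with hP
    -- exponent with `P` removed at `j`
    obtain ⟨d', hd'⟩ : ∃ d' : Fin n → ℕ, (fun i => p ^ α i - 1) + Pi.single j (t * W)
        = d' + Pi.single j P := by
      refine ⟨(fun i => p ^ α i - 1) + Pi.single j (t * W) - Pi.single j P, ?_⟩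
      funext i
      by_cases hi : i = j
      · subst hi; simp; omega
      · simp [hi]
    have hd2 : (fun i => p ^ α i - 1) + Pi.single j ((t + 1) * W)
        = d' + Pi.single j (p ^ α j) := by
      rw [hpe, add_mul, one_mul, Pi.single_add, ← add_assoc, hd', Pi.single_add]
      abel
    have hsum : ∑ i, (p ^ α i - 1) + t * W = ∑ i, d' i + P := by
      have := congrArg (fun g : Fin n → ℕ => ∑ i, g i) hd'
      simpa [Finset.sum_add_distrib] using this
    rw [hd2, iterD_reduce e d' f j _ (pow_pos hp.pos _) (he j), smul_neg, neg_eq_zero,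
      Finset.smul_sum, Finset.sum_eq_single (P - 1)] at h
    · obtain ⟨i, c, -, -, hc, hpc, -, -, hi1⟩ :=
        choose_fact p hp (α j) P hpos (by omega)
      rw [Nat.sub_add_cancel hpos, hc, hi1 rfl, pow_one, ← mul_smul, ← mul_assoc, ← pow_succ,
        mul_comm, mul_smul, ← hd'] at h
      set g := p ^ (m + 1) • iterD e ((fun i => p ^ α i - 1) + Pi.single j (t * W)) f
      have hg : p ^ β • g = 0 := by funext x; rw [Pi.smul_apply, hB]; rfl
      have o1 : addOrderOf g ∣ c := addOrderOf_dvd_of_nsmul_eq_zero h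
      have o2 : addOrderOf g ∣ p ^ β := addOrderOf_dvd_of_nsmul_eq_zero hg
      have hcop : Nat.Coprime c (p ^ β) :=
        Nat.Coprime.pow_right _ ((Nat.Prime.coprime_iff_not_dvd hp).2 hpc).symm
      have := Nat.dvd_gcd o1 o2
      rw [hcop] at this
      exact AddMonoid.addOrderOf_eq_one_iff.1 (Nat.dvd_one.1 this)
    · intro k hk hkP
      rw [Finset.mem_range] at hk
      obtain ⟨i, c, hi, -, hc, -, -, hlt, -⟩ :=
        choose_fact p hp (α j) (k+1) (by omega) (by omega)
      have hlt' := hlt (by omega)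
      rw [hc, ← mul_smul, ← mul_assoc, ← pow_add, mul_comm, mul_smul,
        upper p hp e α (α j) ha he β hB f β, smul_zero]
      · omega
      · simp only [Pi.add_apply, Finset.sum_add_distrib, Finset.sum_pi_single', Finset.mem_univ,
          if_true, Finset.sum_pi_single]
        rw [← hW] at hlt' ⊢
        have : β - 1 = m + (t + 1) := by omega
        rw [this]
        simp only [add_mul, one_mul]
        omega
    · intro hnot
      exact absurd (Finset.mem_range.2 (by omega)) hnot
end

theorem final_eval (n : ℕ) (q : Fin n → ℕ) (hq : ∀ j, 0 < q j) (R : Type*) [CommRing R] :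
    ∃ f : (∀ j : Fin n, ZMod (q j)) → R,
      iterD (fun j => Pi.single j (1 : ZMod (q j))) (fun j => q j - 1) f 0 = 1 := by
  classical
  have key : ∀ (l : List (Fin n)), l.Nodup → ∀ h : ∀ j, ZMod (q j) → R,
      foldD (fun j => Pi.single j (1 : ZMod (q j))) l (fun j => q j - 1)
        (fun x => ∏ j, h j (x j)) =
      fun x => ∏ j, (if j ∈ l then (dOp (1 : ZMod (q j)))^[q j - 1] (h j) else h j) (x j) := by
    have one : ∀ (i : Fin n) (k : ℕ) (h : ∀ j, ZMod (q j) → R),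
        (dOp (Pi.single i (1 : ZMod (q i)) : ∀ j, ZMod (q j)))^[k] (fun x => ∏ j, h j (x j)) =
        fun x => ∏ j, (Function.update h i ((dOp (1 : ZMod (q i)))^[k] (h i))) j (x j) := by
      intro i k
      induction k with
      | zero => intro h; simp
      | succ k ih =>
        intro h
        rw [Function.iterate_succ_apply', ih, Function.iterate_succ_apply']
        funext x
        simp only [dOp]
        rw [← Finset.mul_prod_erase _ _ (Finset.mem_univ i),
          ← Finset.mul_prod_erase _ _ (Finset.mem_univ i),
          ← Finset.mul_prod_erase _ _ (Finset.mem_univ i)]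
        have c1 : ∀ (u : ZMod (q i) → R) (y : ∀ j, ZMod (q j)), (∀ j, j ≠ i → y j = x j) →
            ∏ j ∈ Finset.univ.erase i, (Function.update h i u) j (y j) =
            ∏ j ∈ Finset.univ.erase i, h j (x j) := by
          intro u y hy
          apply Finset.prod_congr rfl
          intro j hj
          have hji := Finset.ne_of_mem_erase hj
          rw [hy j hji, Function.update_of_ne hji]
        rw [c1 _ (x + _) (by intro j hj; simp [hj]), c1 _ x (fun _ _ => rfl),
          c1 _ x (fun _ _ => rfl)]
        simp only [Function.update_self, Pi.add_apply, Pi.single_eq_same, dOp]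
        ring
    intro l
    induction l with
    | nil => intro _ h; simp [foldD]
    | cons i t ih =>
      intro hl h
      rw [List.nodup_cons] at hl
      rw [foldD_cons, ih hl.2, one]
      funext x
      apply Finset.prod_congr rfl
      intro j _
      by_cases hji : j = i
      · subst hji; simp [hl.1]
      · rw [Function.update_of_ne hji]; simp [hji]
  refine ⟨fun x => ∏ j, (if x j = -1 then (1 : R) else 0), ?_⟩
  have := key (List.finRange n) (List.nodup_finRange n) (fun j y => if y = -1 then (1 : R) else 0)
  have h2 := congrFun this 0
  refine Eq.trans h2 ?_
  apply Finset.prod_eq_one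
  intro j _
  rw [if_pos (by simp)]
  have hs := fwdDiff_iter_eq_sum_shift (1 : ZMod (q j))
    (fun y : ZMod (q j) => if y = -1 then (1 : R) else 0) (q j - 1) 0
  refine Eq.trans hs ?_
  have hcast : ∀ k : ℕ, ((0 : ZMod (q j)) + k • (1 : ZMod (q j)) = -1) ↔ q j ∣ k + 1 := by
    intro k
    rw [zero_add, nsmul_one, eq_neg_iff_add_eq_zero, ← ZMod.natCast_eq_zero_iff]
    push_cast
    rfl
  rw [Finset.sum_eq_single (q j - 1)]
  · have : q j ∣ q j - 1 + 1 := by rw [Nat.sub_add_cancel (hq j)]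
    simp only [hcast, this, if_true]
    simp
  · intro k hk hne
    rw [Finset.mem_range] at hk
    have : ¬ q j ∣ k + 1 := fun h => by
      have := Nat.le_of_dvd (by omega) h
      omega
    simp only [hcast, this, if_false, smul_zero]
  · intro h; exact absurd (Finset.mem_range.2 (by omega)) h

/-- Every `f : ℤ/p^{α₁}ℤ × ⋯ × ℤ/p^{αₙ}ℤ → ℤ/p^βℤ` has functional degree at most
`∑ⱼ p^{αⱼ} - n + (β-1)(p-1)p^{α_max-1}`, and this bound is attained. -/
theorem max_fdeg_p_groups (p : ℕ) (hp : p.Prime) (n : ℕ) (hn : 0 < n)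
    (α : Fin n → ℕ) (hα : ∀ j, 1 ≤ α j) (β : ℕ) (hβ : 1 ≤ β) :
    (∀ f : (∀ j : Fin n, ZMod (p ^ α j)) → ZMod (p ^ β),
        ∀ d : Fin n → ℕ,
          (∑ j, d j) >
            (∑ j, p ^ α j) - n + (β - 1) * (p - 1) * p ^ (Finset.univ.sup α - 1) →
          iterD (fun j => Pi.single j (1 : ZMod (p ^ α j))) d f = 0) ∧
      (∃ f : (∀ j : Fin n, ZMod (p ^ α j)) → ZMod (p ^ β), ∃ d : Fin n → ℕ,
        (∑ j, d j) =
            (∑ j, p ^ α j) - n + (β - 1) * (p - 1) * p ^ (Finset.univ.sup α - 1) ∧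
          iterD (fun j => Pi.single j (1 : ZMod (p ^ α j))) d f ≠ 0) := by
  have hsum : (∑ j, p ^ α j) - n = ∑ j, (p ^ α j - 1) := by
    have : ∑ j, p ^ α j = ∑ j, (p ^ α j - 1) + n := by
      have h : ∀ j, p ^ α j = (p ^ α j - 1) + 1 := fun j => by
        have := pow_pos hp.pos (α j); omega
      conv_lhs => rw [Finset.sum_congr rfl (fun j _ => h j)]
      simp [Finset.sum_add_distrib]
    omega
  have hB : ∀ b : ZMod (p ^ β), p ^ β • b = 0 := by
    intro b; rw [nsmul_eq_mul, ZMod.natCast_self, zero_mul]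
  have he : ∀ j, p ^ α j • (Pi.single j (1 : ZMod (p ^ α j)) : ∀ j, ZMod (p ^ α j)) = 0 := by
    intro j
    rw [← Pi.single_smul, nsmul_eq_mul, ZMod.natCast_self, zero_mul, Pi.single_zero]
  haveI : Nonempty (Fin n) := ⟨⟨0, hn⟩⟩
  obtain ⟨j, -, hj⟩ := Finset.exists_mem_eq_sup (Finset.univ : Finset (Fin n))
    Finset.univ_nonempty α
  have hle : ∀ i, α i ≤ α j := fun i => hj ▸ Finset.le_sup (Finset.mem_univ i)
  rw [hj, hsum, mul_assoc]
  constructor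
  · intro f d hd
    have := upper p hp _ α (α j) hle he β hB f β 0 d (by omega) (by omega)
    simpa using this
  · obtain ⟨f, hf⟩ := final_eval n (fun j => p ^ α j) (fun j => pow_pos hp.pos _) (ZMod (p ^ β))
    refine ⟨f, (fun i => p ^ α i - 1) + Pi.single j ((β - 1) * ((p - 1) * p ^ (α j - 1))),
      ?_, ?_⟩
    · simp [Finset.sum_add_distrib]
    · intro h0
      have h := lower p hp _ α j hle (hα j) he β hB f (β - 1) 0 (by omega) (by rw [h0, smul_zero])
      have h1 := congrFun h 0
      rw [Pi.smul_apply, hf, Pi.zero_apply, nsmul_one, ZMod.natCast_eq_zero_iff] at h1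
      have := (Nat.pow_dvd_pow_iff_le_right hp.one_lt).1 h1
      omega
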